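/- arXiv:1110.4482 — 5 statements merged into one kernel-verified Lean document; each statement's English description precedes it below -/
import Mathlib

section
/- Let X be a random variable uniformly distributed on [0,1). Then for every u > 0, E(e^{u cos(2πX)}) ≤ e^{u²/4}. -/
open MeasureTheory

lemma integral_cos_pow_add_two_zero_two_pi (n : ℕ) :
    ∫ x in (0 : ℝ)..2 * Real.pi, Real.cos x ^ (n + 2)
      = (n + 1) / (n + 2) * ∫ x in (0 : ℝ)..2 * Real.pi, Real.cos x ^ n := by
  rw [integral_cos_pow]
  simp

lemma integral_cos_pow_odd_zero_two_pi (k : ℕ) :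
    ∫ x in (0 : ℝ)..2 * Real.pi, Real.cos x ^ (2 * k + 1) = 0 := by
  induction k with
  | zero => simp
  | succ k ih =>
    rw [show 2 * (k + 1) + 1 = 2 * k + 1 + 2 by ring, integral_cos_pow_add_two_zero_two_pi, ih,
      mul_zero]

lemma mul_integral_cos_pow_even_le (u : ℝ) (k : ℕ) :
    u ^ (2 * k) / (2 * k).factorial * ∫ x in (0 : ℝ)..2 * Real.pi, Real.cos x ^ (2 * k)
      ≤ (u ^ 2 / 4) ^ k / k.factorial * (2 * Real.pi) := by
  induction k with
  | zero => simp
  | succ k ih =>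
    rw [show 2 * (k + 1) = 2 * k + 2 by ring, integral_cos_pow_add_two_zero_two_pi,
      Nat.factorial_succ (2 * k + 1), Nat.factorial_succ (2 * k), Nat.factorial_succ k]
    set I := ∫ x in (0 : ℝ)..2 * Real.pi, Real.cos x ^ (2 * k)
    have hk : (0 : ℝ) < k + 1 := by positivity
    have hf : (0 : ℝ) < (2 * k).factorial := by positivity
    have hg : (0 : ℝ) < k.factorial := by positivity
    push_cast
    calc _ = u ^ 2 / 4 / (k + 1) ^ 2 * (u ^ (2 * k) / (2 * k).factorial * I) := by
          field_simp
          ring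
      _ ≤ u ^ 2 / 4 / (k + 1) ^ 2 * ((u ^ 2 / 4) ^ k / k.factorial * (2 * Real.pi)) := by gcongr
      _ ≤ u ^ 2 / 4 / (k + 1) * ((u ^ 2 / 4) ^ k / k.factorial * (2 * Real.pi)) := by
          have : (k + 1 : ℝ) ≤ (k + 1) ^ 2 := by nlinarith [(Nat.cast_nonneg k : (0 : ℝ) ≤ k)]
          have := Real.pi_pos
          gcongr
      _ = _ := by
          field_simp
          ring

lemma hasSum_integral_exp_mul_cos (u : ℝ) :
    HasSum (fun n : ℕ ↦ u ^ n / n.factorial * ∫ x in (0 : ℝ)..2 * Real.pi, Real.cos x ^ n)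
      (∫ x in (0 : ℝ)..2 * Real.pi, Real.exp (u * Real.cos x)) := by
  simp_rw [← intervalIntegral.integral_const_mul]
  refine intervalIntegral.hasSum_integral_of_dominated_convergence
    (fun n _ ↦ |u| ^ n / n.factorial) (fun n ↦ ?_) (fun n ↦ ?_) ?_ ?_ ?_
  · exact (by fun_prop : Continuous fun x ↦ u ^ n / n.factorial * Real.cos x ^ n)
      |>.aestronglyMeasurable
  · refine .of_forall fun x _ ↦ ?_
    rw [norm_mul, norm_div, norm_pow, norm_pow, Real.norm_natCast, Real.norm_eq_abs,
      Real.norm_eq_abs]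
    exact mul_le_of_le_one_right (by positivity)
      (pow_le_one₀ (abs_nonneg _) (Real.abs_cos_le_one x))
  · exact .of_forall fun x _ ↦ Real.summable_pow_div_factorial |u|
  · exact intervalIntegrable_const
  · refine .of_forall fun x _ ↦ ?_
    have h := NormedSpace.expSeries_div_hasSum_exp (u * Real.cos x)
    rw [← Real.exp_eq_exp_ℝ] at h
    simpa only [mul_pow, div_mul_eq_mul_div] using h

lemma integral_exp_mul_cos_le (u : ℝ) :
    ∫ x in (0 : ℝ)..2 * Real.pi, Real.exp (u * Real.cos x)
      ≤ Real.exp (u ^ 2 / 4) * (2 * Real.pi) := by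
  have heven := (Function.Injective.hasSum_iff (g := fun k : ℕ ↦ 2 * k)
    (mul_right_injective₀ two_ne_zero) (fun n hn ↦ ?_)).2 (hasSum_integral_exp_mul_cos u)
  · have hexp := NormedSpace.expSeries_div_hasSum_exp (u ^ 2 / 4)
    rw [← Real.exp_eq_exp_ℝ] at hexp
    exact hasSum_le (mul_integral_cos_pow_even_le u) heven (hexp.mul_right _)
  · obtain ⟨k, rfl | rfl⟩ := n.even_or_odd'
    · exact (hn ⟨k, rfl⟩).elim
    · rw [integral_cos_pow_odd_zero_two_pi, mul_zero]

/-- If `X` is uniformly distributed on `[0,1)`, then `E(e^{u cos 2πX}) ≤ e^{u²/4}`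
for every `u > 0`. -/
theorem laplace_transform_cos_le
    {Ω : Type*} [MeasurableSpace Ω] (μ : Measure Ω) [IsProbabilityMeasure μ]
    (X : Ω → ℝ) (hmeas : Measurable X)
    (hunif : Measure.map X μ = volume.restrict (Set.Ico (0 : ℝ) 1))
    (u : ℝ) (hu : 0 < u) :
    ∫ ω, Real.exp (u * Real.cos (2 * Real.pi * X ω)) ∂μ ≤ Real.exp (u ^ 2 / 4) := by
  have hcont : Continuous fun x : ℝ ↦ Real.exp (u * Real.cos (2 * Real.pi * x)) := by fun_prop
  have hpi : 0 < 2 * Real.pi := Real.two_pi_pos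
  rw [← integral_map (f := fun x : ℝ ↦ Real.exp (u * Real.cos (2 * Real.pi * x)))
      hmeas.aemeasurable hcont.aestronglyMeasurable, hunif, integral_Ico_eq_integral_Ioc,
    ← intervalIntegral.integral_of_le zero_le_one,
    intervalIntegral.integral_comp_mul_left (fun x ↦ Real.exp (u * Real.cos x)) hpi.ne',
    mul_zero, mul_one, smul_eq_mul, inv_mul_le_iff₀ hpi]
  exact (integral_exp_mul_cos_le u).trans_eq (mul_comm _ _)
end

section
/- Let N ≥ 5 be an integer and let X be a random variable uniformly distributed on ℤ/Nℤ. Then for every u > 0, E(e^{u cos(2πX/N)}) ≤ e^{u²/4}. -/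
open MeasureTheory

open Finset in
/-- The sum of `cos (2πjk/N)` over a full period vanishes unless `N ∣ j`. -/
theorem sum_range_cos_two_pi_mul_div_eq_zero {N j : ℕ} (hj : 0 < j) (hjN : j < N) :
    ∑ k ∈ range N, Real.cos (j * (2 * Real.pi * k / N)) = 0 := by
  have hN : N ≠ 0 := by lia
  have hprim := Complex.isPrimitiveRoot_exp N hN
  set ζ := Complex.exp (2 * Real.pi * Complex.I / N) with hζ
  have hne : ζ ^ j ≠ 1 := hprim.pow_ne_one_of_pos_of_lt hj.ne' hjN
  have hsum : ∑ k ∈ range N, (ζ ^ j) ^ k = 0 := by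
    rw [geom_sum_eq hne, ← pow_mul, mul_comm, pow_mul, hprim.pow_eq_one]
    simp
  have hre := congrArg Complex.re hsum
  rw [Complex.re_sum, Complex.zero_re] at hre
  rw [← hre]
  refine sum_congr rfl fun k _ => ?_
  rw [hζ, ← Complex.exp_nat_mul, ← Complex.exp_nat_mul, ← Complex.exp_ofReal_mul_I_re]
  congr 2
  push_cast
  ring

/-- A fourth-order Taylor upper bound for `exp`, with a geometric bound on the remainder. -/
theorem exp_le_taylor_four {u y : ℝ} (hy : |y| ≤ u) (hu : u < 5) :
    Real.exp y ≤ 1 + y + y ^ 2 / 2 + y ^ 3 / 6 + y ^ 4 / 24 * (1 - u / 5)⁻¹ := by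
  have hu0 : 0 ≤ u := (abs_nonneg y).trans hy
  have hexp : HasSum (fun n : ℕ => y ^ n / n.factorial) (Real.exp y) := by
    rw [Real.exp_eq_exp_ℝ]
    exact NormedSpace.expSeries_div_hasSum_exp y
  have htail := (hasSum_nat_add_iff' 4).2 hexp
  have hgeom := (hasSum_geometric_of_lt_one (r := u / 5) (by positivity) (by linarith)).mul_left
    (y ^ 4 / 24)
  have hle := hasSum_le (fun n => ?_) htail hgeom
  · simp only [Finset.sum_range_succ, Finset.sum_range_zero, Nat.factorial] at hle
    norm_num at hle
    linarith
  · have hfact : (24 : ℝ) * 5 ^ n ≤ (n + 4).factorial := by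
      have := Nat.factorial_mul_pow_le_factorial (m := 4) (n := n)
      rw [add_comm n 4]
      exact_mod_cast this
    have hpow : y ^ n ≤ u ^ n :=
      (le_abs_self _).trans (by rw [abs_pow]; gcongr)
    calc y ^ (n + 4) / ((n + 4).factorial : ℝ) = y ^ 4 * y ^ n / (n + 4).factorial := by ring
      _ ≤ y ^ 4 * u ^ n / (24 * 5 ^ n) := by
        gcongr
      _ = y ^ 4 / 24 * (u / 5) ^ n := by rw [div_pow]; field_simp

theorem quadratic_add_quartic_mul_inv_le_exp {u : ℝ} (hu0 : 0 < u) (hu : u ≤ 4) :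
    1 + u ^ 2 / 4 + u ^ 4 / 64 * (1 - u / 5)⁻¹ ≤ Real.exp (u ^ 2 / 4) := by
  have hexp := Real.sum_le_exp_of_nonneg (x := u ^ 2 / 4) (by positivity) 5
  simp only [Finset.sum_range_succ, Finset.sum_range_zero, Nat.factorial] at hexp
  norm_num at hexp
  have hinv : (1 - u / 5)⁻¹ ≤ 2 + u ^ 2 / 6 + u ^ 4 / 96 := by
    rw [inv_le_iff_one_le_mul₀ (by linarith)]
    have h1 : 0 ≤ u ^ 4 * (4 - u) := mul_nonneg (by positivity) (by linarith)
    nlinarith [mul_nonneg (sq_nonneg (u - 2)) (by linarith : 0 ≤ 4 - u),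
      sq_nonneg (u - 3)]
  have := mul_le_mul_of_nonneg_left hinv (by positivity : 0 ≤ u ^ 4 / 64)
  nlinarith

open Finset in
theorem sum_range_exp_mul_cos_le {N : ℕ} (hN : 5 ≤ N) {u : ℝ} (hu : 0 < u) :
    ∑ k ∈ range N, Real.exp (u * Real.cos (2 * Real.pi * k / N)) ≤ N * Real.exp (u ^ 2 / 4) := by
  rcases le_or_gt u 4 with hu4 | hu4
  · set r := (1 - u / 5)⁻¹
    have hpt (θ : ℝ) : Real.exp (u * Real.cos θ) ≤
        (1 + u ^ 2 / 4 + u ^ 4 / 64 * r) + (u + u ^ 3 / 8) * Real.cos ((1 : ℕ) * θ)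
          + (u ^ 2 / 4 + u ^ 4 / 48 * r) * Real.cos ((2 : ℕ) * θ)
          + u ^ 3 / 24 * Real.cos ((3 : ℕ) * θ)
          + u ^ 4 / 192 * r * Real.cos ((4 : ℕ) * θ) := by
      have habs : |u * Real.cos θ| ≤ u := by
        rw [abs_mul, abs_of_pos hu]
        exact mul_le_of_le_one_right hu.le (Real.abs_cos_le_one θ)
      refine (exp_le_taylor_four habs (by linarith)).trans_eq ?_
      have h4 : Real.cos (4 * θ) = 2 * (2 * Real.cos θ ^ 2 - 1) ^ 2 - 1 := by
        rw [← Real.cos_two_mul, ← Real.cos_two_mul]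
        ring_nf
      push_cast
      rw [one_mul, Real.cos_two_mul, Real.cos_three_mul, h4]
      ring
    refine (sum_le_sum fun (k : ℕ) _ => hpt (2 * Real.pi * k / N)).trans ?_
    simp only [sum_add_distrib, ← mul_sum]
    rw [sum_range_cos_two_pi_mul_div_eq_zero (by simp) (by lia),
      sum_range_cos_two_pi_mul_div_eq_zero (by simp) (by lia),
      sum_range_cos_two_pi_mul_div_eq_zero (by simp) (by lia),
      sum_range_cos_two_pi_mul_div_eq_zero (by simp) (by lia)]
    simp only [sum_const, card_range, nsmul_eq_mul, mul_zero, add_zero]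
    calc _ = N * (1 + u ^ 2 / 4 + u ^ 4 / 64 * r) := by ring
      _ ≤ N * Real.exp (u ^ 2 / 4) := by
        gcongr
        exact quadratic_add_quartic_mul_inv_le_exp hu hu4
  · calc ∑ k ∈ range N, Real.exp (u * Real.cos (2 * Real.pi * k / N))
        ≤ ∑ k ∈ range N, Real.exp (u ^ 2 / 4) := by
          gcongr with k
          nlinarith [Real.cos_le_one (2 * Real.pi * k / N)]
      _ = N * Real.exp (u ^ 2 / 4) := by simp

/-- **Lemma (Kahane).** For `N ≥ 5` and `X` uniform on `ℤ/Nℤ`,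
`E(e^{u cos(2πX/N)}) ≤ e^{u²/4}` for every `u > 0`. -/
theorem laplace_transform_cos_zmod_le
    {Ω : Type*} [MeasurableSpace Ω] (μ : Measure Ω) [IsProbabilityMeasure μ]
    (N : ℕ) [NeZero N] (hN5 : 5 ≤ N)
    (X : Ω → ZMod N) (hmeas : Measurable X)
    (hunif : Measure.map X μ = (PMF.uniformOfFintype (ZMod N)).toMeasure)
    (u : ℝ) (hu : 0 < u) :
    ∫ ω, Real.exp (u * Real.cos (2 * Real.pi * ((X ω).val : ℝ) / N)) ∂μ
      ≤ Real.exp (u ^ 2 / 4) := by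
  let f : ℕ → ℝ := fun k => Real.exp (u * Real.cos (2 * Real.pi * k / N))
  have hsum : ∑ a : ZMod N, f a.val = ∑ k ∈ Finset.range N, f k := by
    obtain ⟨n, rfl⟩ : ∃ n, N = n + 1 := ⟨N - 1, by lia⟩
    exact Fin.sum_univ_eq_sum_range f (n + 1)
  have hint : ∫ ω, f (X ω).val ∂μ = (N : ℝ)⁻¹ * ∑ k ∈ Finset.range N, f k := by
    rw [← integral_map (f := fun a : ZMod N => f a.val) hmeas.aemeasurable
      (measurable_of_finite _).aestronglyMeasurable, hunif, PMF.integral_eq_sum, ← hsum,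
      Finset.mul_sum]
    simp [ZMod.card]
  change ∫ ω, f (X ω).val ∂μ ≤ _
  rw [hint, inv_mul_le_iff₀ (by exact_mod_cast (by lia : 0 < N))]
  exact sum_range_exp_mul_cos_le hN5 hu
end

section
/- For N = 2 and for N = 3, the inequality E(e^{u cos(2πX/N)}) ≤ e^{u²/4} fails: if X is uniformly distributed on ℤ/Nℤ with N ∈ {2, 3}, then there exists u > 0 such that E(e^{u cos(2πX/N)}) > e^{u²/4}. -/
open MeasureTheory

lemma integral_comp_of_map_eq_uniform {Ω α : Type*} [MeasurableSpace Ω] {μ : Measure Ω}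
    [Fintype α] [Nonempty α] [MeasurableSpace α] [MeasurableSingletonClass α]
    {X : Ω → α} (hmeas : Measurable X)
    (hunif : Measure.map X μ = (PMF.uniformOfFintype α).toMeasure) (f : α → ℝ) :
    ∫ ω, f (X ω) ∂μ = (∑ a, f a) / Fintype.card α := by
  have hf : AEStronglyMeasurable f (Measure.map X μ) :=
    (measurable_of_finite f).aestronglyMeasurable
  rw [← integral_map hmeas.aemeasurable hf, hunif, PMF.integral_eq_sum, Finset.sum_div]
  refine Finset.sum_congr rfl fun a _ => ?_
  simp [div_eq_inv_mul]

lemma exp_quarter_lt : Real.exp (1 / 4) < 1.29 := by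
  have h : Real.exp (1 / 4) ^ 4 = Real.exp 1 := by
    rw [← Real.exp_nat_mul]
    norm_num
  refine lt_of_pow_lt_pow_left₀ 4 (by norm_num) ?_
  rw [h]
  exact Real.exp_one_lt_d9.trans (by norm_num)

lemma lt_exp_neg_half : 0.6 < Real.exp (-(1 / 2)) := by
  have h : Real.exp (1 / 2) ^ 2 = Real.exp 1 := by
    rw [← Real.exp_nat_mul]
    norm_num
  have h' : Real.exp (1 / 2) < 5 / 3 := by
    refine lt_of_pow_lt_pow_left₀ 2 (by norm_num) ?_
    rw [h]
    exact Real.exp_one_lt_d9.trans (by norm_num)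
  rw [Real.exp_neg, lt_inv_comm₀ (by norm_num) (Real.exp_pos _)]
  exact h'.trans_le (by norm_num)

lemma cos_two_pi_div_three : Real.cos (2 * Real.pi / 3) = -(1 / 2) := by
  rw [show 2 * Real.pi / 3 = Real.pi - Real.pi / 3 by ring, Real.cos_pi_sub,
    Real.cos_pi_div_three]

lemma cos_four_pi_div_three : Real.cos (2 * Real.pi * 2 / 3) = -(1 / 2) := by
  rw [show 2 * Real.pi * 2 / 3 = Real.pi / 3 + Real.pi by ring, Real.cos_add_pi,
    Real.cos_pi_div_three]

/-- For `N = 2` and `N = 3` the inequality `E(e^{u cos(2πX/N)}) ≤ e^{u²/4}` fails: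
there is `u > 0` with `E(e^{u cos(2πX/N)}) > e^{u²/4}`. -/
theorem laplace_transform_cos_zmod_fails
    {Ω : Type*} [MeasurableSpace Ω] (μ : Measure Ω) [IsProbabilityMeasure μ]
    (N : ℕ) [NeZero N] (hN : N = 2 ∨ N = 3)
    (X : Ω → ZMod N) (hmeas : Measurable X)
    (hunif : Measure.map X μ = (PMF.uniformOfFintype (ZMod N)).toMeasure) :
    ∃ u : ℝ, 0 < u ∧
      Real.exp (u ^ 2 / 4) <
        ∫ ω, Real.exp (u * Real.cos (2 * Real.pi * ((X ω).val : ℝ) / N)) ∂μ := by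
  refine ⟨1, one_pos, ?_⟩
  rw [integral_comp_of_map_eq_uniform hmeas hunif
    (fun a => Real.exp (1 * Real.cos (2 * Real.pi * (a.val : ℝ) / N))), ZMod.card, one_pow]
  have h4 := exp_quarter_lt
  have h1 := Real.exp_one_gt_d9
  have h2 := lt_exp_neg_half
  rcases hN with rfl | rfl
  · have hsum : ∑ a : ZMod 2, Real.exp (1 * Real.cos (2 * Real.pi * (a.val : ℝ) / (2 : ℕ)))
        = Real.exp 1 + Real.exp (-1) := by
      rw [show (Finset.univ : Finset (ZMod 2)) = {0, 1} from rfl,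
        Finset.sum_pair (by decide), ZMod.val_zero, ZMod.val_one]
      norm_num
    have h3 : Real.exp (-1) = Real.exp (-(1 / 2)) ^ 2 := by
      rw [← Real.exp_nat_mul]
      norm_num
    have h5 : 0.36 < Real.exp (-1) := by rw [h3]; nlinarith
    rw [hsum]
    push_cast
    linarith
  · have hsum : ∑ a : ZMod 3, Real.exp (1 * Real.cos (2 * Real.pi * (a.val : ℝ) / (3 : ℕ)))
        = Real.exp 1 + 2 * Real.exp (-(1 / 2)) := by
      have hval : (2 : ZMod 3).val = 2 := rfl
      rw [show (Finset.univ : Finset (ZMod 3)) = {0, 1, 2} from rfl,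
        Finset.sum_insert (by decide), Finset.sum_pair (by decide), ZMod.val_zero,
        show (1 : ZMod 3).val = 1 from rfl, hval]
      push_cast
      rw [mul_one (2 * Real.pi), cos_two_pi_div_three, cos_four_pi_div_three, mul_zero, zero_div,
        Real.cos_zero]
      ring_nf
    rw [hsum]
    push_cast
    linarith
end

section
/- Let N ≥ 5 be an integer, let X be a random variable uniformly distributed on ℤ/Nℤ, let u > 0 and let φ ∈ ℝ. Then E(e^{u cos(2πX/N − φ)}) ≤ E(e^{u cos(2πX/N)}). -/
open MeasureTheory

/-- The sum of the powers of a root of unity is a nonnegative real number. -/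
theorem geom_sum_root_of_unity_eq_natCast {N : ℕ} {r : ℂ} (hr : r ^ N = 1) :
    ∃ m : ℕ, ∑ k ∈ Finset.range N, r ^ k = m := by
  by_cases h : r = 1
  · exact ⟨N, by simp [h]⟩
  · refine ⟨0, ?_⟩
    have hmul := mul_geom_sum r N
    rw [hr, sub_self] at hmul
    simpa using (mul_eq_zero.mp hmul).resolve_left (sub_ne_zero.mpr h)

/-- The power sums of `cos` over a shifted regular polygon are given by a binomial expansion. -/
theorem sum_two_mul_cos_sub_pow (N n : ℕ) (φ : ℝ) :
    ((∑ k ∈ Finset.range N, (2 * Real.cos (2 * Real.pi * (k : ℝ) / N - φ)) ^ n : ℝ) : ℂ) =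
      ∑ j ∈ Finset.range (n + 1),
        Complex.exp (((-φ * (j - (n - j : ℕ)) : ℝ) : ℂ) * Complex.I) * ((n.choose j : ℂ) *
          ∑ k ∈ Finset.range N,
            Complex.exp ((2 * Real.pi * (j - (n - j : ℕ)) / N : ℂ) * Complex.I) ^ k) := by
  push_cast
  simp only [Complex.two_cos, add_pow, Finset.mul_sum]
  rw [Finset.sum_comm]
  refine Finset.sum_congr rfl fun j _ => Finset.sum_congr rfl fun k _ => ?_
  simp only [← Complex.exp_nat_mul]
  rw [mul_left_comm (Complex.exp _), ← Complex.exp_add, ← Complex.exp_add, mul_comm]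
  congr 2
  ring

theorem sum_cos_sub_pow_le {N : ℕ} (hN : N ≠ 0) (n : ℕ) (φ : ℝ) :
    ∑ k ∈ Finset.range N, Real.cos (2 * Real.pi * (k : ℝ) / N - φ) ^ n ≤
      ∑ k ∈ Finset.range N, Real.cos (2 * Real.pi * (k : ℝ) / N) ^ n := by
  have hroot (j : ℕ) :
      Complex.exp ((2 * Real.pi * (j - (n - j : ℕ)) / N : ℂ) * Complex.I) ^ N = 1 := by
    rw [← Complex.exp_nat_mul, Complex.exp_eq_one_iff]
    refine ⟨j - (n - j : ℕ), ?_⟩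
    have : (N : ℂ) ≠ 0 := by exact_mod_cast hN
    push_cast
    field_simp
  choose m hm using fun j => geom_sum_root_of_unity_eq_natCast (hroot j)
  have hre (ψ : ℝ) :
      ∑ k ∈ Finset.range N, (2 * Real.cos (2 * Real.pi * (k : ℝ) / N - ψ)) ^ n =
        ∑ j ∈ Finset.range (n + 1),
          Real.cos (-ψ * (j - (n - j : ℕ))) * ((n.choose j : ℝ) * m j) := by
    have h := congrArg Complex.re (sum_two_mul_cos_sub_pow N n ψ)
    simp only [hm, Complex.ofReal_re, Complex.re_sum] at h
    rw [h]
    refine Finset.sum_congr rfl fun j _ => ?_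
    rw [← Complex.exp_ofReal_mul_I_re, ← Complex.re_mul_ofReal]
    push_cast
    rfl
  have hle : ∑ k ∈ Finset.range N, (2 * Real.cos (2 * Real.pi * (k : ℝ) / N - φ)) ^ n ≤
      ∑ k ∈ Finset.range N, (2 * Real.cos (2 * Real.pi * (k : ℝ) / N - 0)) ^ n := by
    rw [hre, hre]
    refine Finset.sum_le_sum fun j _ => mul_le_mul_of_nonneg_right ?_ (by positivity)
    simpa using Real.cos_le_one _
  simp only [mul_pow, ← Finset.mul_sum, sub_zero] at hle
  exact le_of_mul_le_mul_left hle (by positivity)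

theorem sum_exp_mul_cos_sub_le {N : ℕ} (hN : N ≠ 0) {u : ℝ} (hu : 0 ≤ u) (φ : ℝ) :
    ∑ k ∈ Finset.range N, Real.exp (u * Real.cos (2 * Real.pi * (k : ℝ) / N - φ)) ≤
      ∑ k ∈ Finset.range N, Real.exp (u * Real.cos (2 * Real.pi * (k : ℝ) / N)) := by
  have hexp (x : ℝ) : HasSum (fun n : ℕ => x ^ n / n.factorial) (Real.exp x) := by
    rw [Real.exp_eq_exp_ℝ]
    exact NormedSpace.expSeries_div_hasSum_exp x
  refine hasSum_le (fun n => ?_) (hasSum_sum fun k _ => hexp _) (hasSum_sum fun k _ => hexp _)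
  simp only [mul_pow, ← Finset.sum_div, ← Finset.mul_sum]
  gcongr ?_ / _
  exact mul_le_mul_of_nonneg_left (sum_cos_sub_pow_le hN n φ) (by positivity)

theorem integral_comp_val_of_map_eq_uniform
    {Ω : Type*} [MeasurableSpace Ω] {μ : Measure Ω} {N : ℕ} [NeZero N]
    {X : Ω → ZMod N} (hmeas : Measurable X)
    (hunif : Measure.map X μ = (PMF.uniformOfFintype (ZMod N)).toMeasure) (f : ℕ → ℝ) :
    ∫ ω, f (X ω).val ∂μ = (N : ℝ)⁻¹ * ∑ k ∈ Finset.range N, f k := by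
  have hsum : ∑ a : ZMod N, f a.val = ∑ k ∈ Finset.range N, f k := by
    obtain ⟨n, rfl⟩ := Nat.exists_eq_succ_of_ne_zero (NeZero.ne N)
    exact Fin.sum_univ_eq_sum_range f (n + 1)
  rw [← integral_map (f := fun a : ZMod N => f a.val) hmeas.aemeasurable
    (measurable_of_finite _).aestronglyMeasurable, hunif, PMF.integral_eq_sum]
  simp [← Finset.mul_sum, hsum, ZMod.card]

/-- For `N ≥ 5`, `X` uniform on `ℤ/Nℤ`, `u > 0` and `φ ∈ ℝ`,
`E(e^{u cos(2πX/N − φ)}) ≤ E(e^{u cos(2πX/N)})`. -/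
theorem laplace_transform_cos_shift_le
    {Ω : Type*} [MeasurableSpace Ω] (μ : Measure Ω) [IsProbabilityMeasure μ]
    (N : ℕ) [NeZero N] (hN5 : 5 ≤ N)
    (X : Ω → ZMod N) (hmeas : Measurable X)
    (hunif : Measure.map X μ = (PMF.uniformOfFintype (ZMod N)).toMeasure)
    (u : ℝ) (hu : 0 < u) (φ : ℝ) :
    ∫ ω, Real.exp (u * Real.cos (2 * Real.pi * ((X ω).val : ℝ) / N - φ)) ∂μ
      ≤ ∫ ω, Real.exp (u * Real.cos (2 * Real.pi * ((X ω).val : ℝ) / N)) ∂μ := by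
  rw [integral_comp_val_of_map_eq_uniform hmeas hunif
      fun k => Real.exp (u * Real.cos (2 * Real.pi * (k : ℝ) / N - φ)),
    integral_comp_val_of_map_eq_uniform hmeas hunif
      fun k => Real.exp (u * Real.cos (2 * Real.pi * (k : ℝ) / N))]
  exact mul_le_mul_of_nonneg_left (sum_exp_mul_cos_sub_le (NeZero.ne N) hu.le φ) (by positivity)
end

section
/- Let N ≥ 5 be an integer, let X be a random variable uniformly distributed on ℤ/Nℤ, and for each integer k ≥ 0 set J_k = E((cos(2πX/N))^k). Then for every integer k ≥ 1, 2k·J_{2k−1} + J_{2k} + J_{2k+1}/(2k+1) ≤ (2k)!/(4^k k!). -/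
open MeasureTheory

theorem sum_cos_two_pi_mul_div_eq_zero {N m : ℕ} (hm : 0 < m) (hmN : m < N) :
    ∑ j ∈ Finset.range N, Real.cos (m * (2 * Real.pi * (j : ℝ) / N)) = 0 := by
  have hN : N ≠ 0 := by omega
  have hζ := Complex.isPrimitiveRoot_exp N hN
  set ζ := Complex.exp (2 * Real.pi * Complex.I / N) with hζdef
  have hne : ζ ^ m ≠ 1 := hζ.pow_ne_one_of_pos_of_lt hm.ne' hmN
  have hsum : ∑ j ∈ Finset.range N, (ζ ^ m) ^ j = 0 := by
    have hmul := geom_sum_mul (ζ ^ m) N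
    rw [← pow_mul, mul_comm m N, pow_mul, hζ.pow_eq_one, one_pow, sub_self] at hmul
    exact (mul_eq_zero.mp hmul).resolve_right (sub_ne_zero.mpr hne)
  have hre := congrArg Complex.re hsum
  rw [Complex.re_sum, Complex.zero_re] at hre
  rw [← hre]
  refine Finset.sum_congr rfl fun j _ => ?_
  have harg : (ζ ^ m) ^ j =
      Complex.exp (((m * (2 * Real.pi * (j : ℝ) / N) : ℝ) : ℂ) * Complex.I) := by
    rw [hζdef, ← pow_mul, ← Complex.exp_nat_mul]
    congr 1
    push_cast
    ring
  rw [harg, Complex.exp_ofReal_mul_I_re]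

theorem ZMod.sum_val_eq_sum_range {M : Type*} [AddCommMonoid M] (N : ℕ) [NeZero N] (f : ℕ → M) :
    ∑ x : ZMod N, f x.val = ∑ j ∈ Finset.range N, f j := by
  obtain _ | n := N
  · exact absurd rfl (NeZero.ne 0)
  · exact Fin.sum_univ_eq_sum_range f (n + 1)

theorem integral_cos_mul_eq_zero_of_uniform
    {Ω : Type*} [MeasurableSpace Ω] (μ : Measure Ω) (N : ℕ) [NeZero N]
    (X : Ω → ZMod N) (hmeas : Measurable X)
    (hunif : Measure.map X μ = (PMF.uniformOfFintype (ZMod N)).toMeasure)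
    {m : ℕ} (hm : 0 < m) (hmN : m < N) :
    ∫ ω, Real.cos (m * (2 * Real.pi * ((X ω).val : ℝ) / N)) ∂μ = 0 := by
  rw [← integral_map (φ := X) (f := fun x => Real.cos (m * (2 * Real.pi * (x.val : ℝ) / N)))
    hmeas.aemeasurable (by fun_prop), hunif, PMF.integral_eq_sum]
  simp only [PMF.uniformOfFintype_apply, smul_eq_mul]
  rw [← Finset.mul_sum,
    ZMod.sum_val_eq_sum_range N (fun j => Real.cos (m * (2 * Real.pi * (j : ℝ) / N))),
    sum_cos_two_pi_mul_div_eq_zero hm hmN, mul_zero]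

theorem factorial_two_mul_succ_div (k : ℕ) :
    ((2 * (k + 1)).factorial : ℝ) / (4 ^ (k + 1) * ((k + 1).factorial : ℝ)) =
      (2 * k + 1) / 2 * (((2 * k).factorial : ℝ) / (4 ^ k * (k.factorial : ℝ))) := by
  rw [show 2 * (k + 1) = 2 * k + 1 + 1 by ring, Nat.factorial_succ, Nat.factorial_succ,
    Nat.factorial_succ]
  push_cast
  have := Nat.factorial_ne_zero k
  field_simp
  ring

theorem add_one_le_factorial_div {k : ℕ} (hk : 4 ≤ k) :
    (k : ℝ) + 1 ≤ ((2 * k).factorial : ℝ) / (4 ^ k * (k.factorial : ℝ)) := by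
  induction k, hk using Nat.le_induction with
  | base => norm_num [Nat.factorial]
  | succ n hn ih =>
    rw [factorial_two_mul_succ_div]
    have hn' : (4 : ℝ) ≤ n := by exact_mod_cast hn
    push_cast
    nlinarith

/-- For `N ≥ 5`, `X` uniform on `ℤ/Nℤ` and `J_k = E((cos(2πX/N))^k)`,
one has `2k·J_{2k−1} + J_{2k} + J_{2k+1}/(2k+1) ≤ (2k)!/(4^k k!)` for every `k ≥ 1`. -/
theorem moments_combination_le
    {Ω : Type*} [MeasurableSpace Ω] (μ : Measure Ω) [IsProbabilityMeasure μ]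
    (N : ℕ) [NeZero N] (hN5 : 5 ≤ N)
    (X : Ω → ZMod N) (hmeas : Measurable X)
    (hunif : Measure.map X μ = (PMF.uniformOfFintype (ZMod N)).toMeasure)
    (J : ℕ → ℝ)
    (hJ : ∀ k : ℕ, J k = ∫ ω, (Real.cos (2 * Real.pi * ((X ω).val : ℝ) / N)) ^ k ∂μ)
    (k : ℕ) (hk : 1 ≤ k) :
    2 * (k : ℝ) * J (2 * k - 1) + J (2 * k) + J (2 * k + 1) / (2 * (k : ℝ) + 1)
      ≤ ((2 * k).factorial : ℝ) / (4 ^ k * (k.factorial : ℝ)) := by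
  set θ : Ω → ℝ := fun ω => 2 * Real.pi * ((X ω).val : ℝ) / N
  have hθm : Measurable θ :=
    (measurable_from_top (f := fun x : ZMod N => 2 * Real.pi * (x.val : ℝ) / N)).comp hmeas
  have hpow : ∀ n : ℕ, Integrable (fun ω => Real.cos (θ ω) ^ n) μ := fun n =>
    Integrable.of_bound (by fun_prop) 1 (.of_forall fun ω => by
      rw [Real.norm_eq_abs, abs_pow]
      exact pow_le_one₀ (abs_nonneg _) (Real.abs_cos_le_one _))
  have hzero : ∀ m : ℕ, 0 < m → m < 5 → ∫ ω, Real.cos (m * θ ω) ∂μ = 0 := fun m hm hm5 =>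
    integral_cos_mul_eq_zero_of_uniform μ N X hmeas hunif hm (by omega)
  have hJ0 : J 0 = 1 := by simp [hJ]
  have hJ1 : J 1 = 0 := by
    rw [hJ]
    simpa only [Nat.cast_one, one_mul, pow_one] using hzero 1 (by norm_num) (by norm_num)
  have hJ2 : J 2 = 1 / 2 := by
    have h := hzero 2 (by norm_num) (by norm_num)
    have hexp : ∀ ω, Real.cos ((2 : ℕ) * θ ω) =
        2 * Real.cos (θ ω) ^ 2 - Real.cos (θ ω) ^ 0 := fun ω => by
      push_cast; rw [Real.cos_two_mul, pow_zero]
    simp_rw [hexp] at h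
    rw [integral_sub ((hpow 2).const_mul 2) (hpow 0), integral_const_mul, ← hJ, ← hJ, hJ0] at h
    linarith
  have hJ3 : J 3 = 0 := by
    have h := hzero 3 (by norm_num) (by norm_num)
    have hexp : ∀ ω, Real.cos ((3 : ℕ) * θ ω) =
        4 * Real.cos (θ ω) ^ 3 - 3 * Real.cos (θ ω) ^ 1 := fun ω => by
      push_cast; rw [Real.cos_three_mul, pow_one]
    simp_rw [hexp] at h
    rw [integral_sub ((hpow 3).const_mul 4) ((hpow 1).const_mul 3), integral_const_mul,
      integral_const_mul, ← hJ, ← hJ, hJ1] at h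
    linarith
  have hJ4 : J 4 = 3 / 8 := by
    have h := hzero 4 (by norm_num) (by norm_num)
    have hexp : ∀ ω, Real.cos ((4 : ℕ) * θ ω) =
        8 * Real.cos (θ ω) ^ 4 - 8 * Real.cos (θ ω) ^ 2 + Real.cos (θ ω) ^ 0 := fun ω => by
      rw [show ((4 : ℕ) : ℝ) * θ ω = 2 * (2 * θ ω) by push_cast; ring, Real.cos_two_mul,
        Real.cos_two_mul]
      ring
    simp_rw [hexp] at h
    have hdiff : Integrable (fun ω => 8 * Real.cos (θ ω) ^ 4 - 8 * Real.cos (θ ω) ^ 2) μ :=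
      ((hpow 4).const_mul 8).sub ((hpow 2).const_mul 8)
    rw [integral_add hdiff (hpow 0), integral_sub ((hpow 4).const_mul 8) ((hpow 2).const_mul 8),
      integral_const_mul, integral_const_mul, ← hJ, ← hJ, ← hJ, hJ0, hJ2] at h
    linarith
  have hJ5 : J 5 ≤ 1 / 16 := by
    have hexp : ∀ ω, 16 * Real.cos (θ ω) ^ 5 ≤
        20 * Real.cos (θ ω) ^ 3 - 5 * Real.cos (θ ω) ^ 1 + Real.cos (θ ω) ^ 0 := fun ω => by
      have h5 : Real.cos (5 * θ ω) =
          16 * Real.cos (θ ω) ^ 5 - 20 * Real.cos (θ ω) ^ 3 + 5 * Real.cos (θ ω) := by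
        rw [show 5 * θ ω = 3 * θ ω + 2 * θ ω by ring, Real.cos_add, Real.cos_three_mul,
          Real.cos_two_mul, Real.sin_three_mul, Real.sin_two_mul]
        linear_combination (6 * Real.cos (θ ω) - 8 * Real.cos (θ ω) * Real.sin (θ ω) ^ 2
          - 8 * Real.cos (θ ω) * (1 - Real.cos (θ ω) ^ 2)) * (-1) *
          Real.sin_sq_add_cos_sq (θ ω)
      have := Real.cos_le_one (5 * θ ω)
      rw [pow_one, pow_zero]
      linarith
    have hdiff : Integrable (fun ω => 20 * Real.cos (θ ω) ^ 3 - 5 * Real.cos (θ ω) ^ 1) μ :=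
      ((hpow 3).const_mul 20).sub ((hpow 1).const_mul 5)
    have h := integral_mono ((hpow 5).const_mul 16) (hdiff.add (hpow 0)) hexp
    simp only [Pi.add_apply] at h
    rw [integral_add hdiff (hpow 0),
      integral_sub ((hpow 3).const_mul 20) ((hpow 1).const_mul 5), integral_const_mul,
      integral_const_mul, integral_const_mul, ← hJ, ← hJ, ← hJ, ← hJ, hJ0, hJ1, hJ3] at h
    linarith
  have hJle : ∀ n, 4 ≤ n → J n ≤ 3 / 8 := fun n hn => by
    rw [← hJ4, hJ, hJ]
    refine integral_mono (hpow n) (hpow 4) fun ω => ?_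
    calc Real.cos (θ ω) ^ n ≤ |Real.cos (θ ω)| ^ n := (le_abs_self _).trans_eq (abs_pow _ _)
      _ ≤ |Real.cos (θ ω)| ^ 4 :=
        pow_le_pow_of_le_one (abs_nonneg _) (Real.abs_cos_le_one _) hn
      _ = Real.cos (θ ω) ^ 4 := Even.pow_abs (by decide) _
  obtain rfl | rfl | rfl | hk4 : k = 1 ∨ k = 2 ∨ k = 3 ∨ 4 ≤ k := by omega
  · norm_num [hJ1, hJ2, hJ3, Nat.factorial]
  · norm_num [hJ3, hJ4, Nat.factorial]
    linarith
  · have h6 := hJle 6 (by norm_num)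
    have h7 := hJle 7 (by norm_num)
    norm_num [Nat.factorial]
    linarith
  · refine le_trans ?_ (add_one_le_factorial_div hk4)
    have ha := hJle (2 * k - 1) (by omega)
    have hb := hJle (2 * k) (by omega)
    have hc := hJle (2 * k + 1) (by omega)
    have hk' : (4 : ℝ) ≤ k := by exact_mod_cast hk4
    have hd : J (2 * k + 1) / (2 * (k : ℝ) + 1) ≤ 3 / 8 := by
      rw [div_le_iff₀ (by positivity)]
      nlinarith
    nlinarith
end
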